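/- arXiv:1605.04840 — 2 statements merged into one kernel-verified Lean document; each statement's English description precedes it below -/
import Mathlib

section
/- Let n ≥ 1, let Ω ⊂ ℝ² be a closed bounded rectangle, let H ∈ C³(Ω) be such that the partial derivatives H_x and H_y never vanish on Ω, let a, b > 0, and let μ be a probability measure on ℝⁿ that is absolutely continuous with respect to Lebesgue measure and satisfies ∫_{ℝⁿ} ‖x‖⁵ dμ(x) < ∞. If H satisfies inequality (★) for μ, then: (i) a² H_xx/H_x² + (1−a²−b²) H_xy/(H_x H_y) + b² H_yy/H_y² ≥ 0 at every interior point of Ω; (ii) |1−a²−b²| ≤ 2ab; and (iii) if a+b > 1 then ∫_{ℝⁿ} x dμ(x) = 0. -/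
open MeasureTheory Real Filter

noncomputable section

/-- `ℝⁿ` with the Euclidean structure. -/
abbrev Euc (n : ℕ) := EuclideanSpace ℝ (Fin n)

/-- First partial derivative `H_x`. -/
def Hx (H : ℝ × ℝ → ℝ) (z : ℝ × ℝ) : ℝ := fderiv ℝ H z (1, 0)
/-- First partial derivative `H_y`. -/
def Hy (H : ℝ × ℝ → ℝ) (z : ℝ × ℝ) : ℝ := fderiv ℝ H z (0, 1)
/-- Second partial derivative `H_xx`. -/
def Hxx (H : ℝ × ℝ → ℝ) (z : ℝ × ℝ) : ℝ := fderiv ℝ (Hx H) z (1, 0)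
/-- Second partial derivative `H_xy`. -/
def Hxy (H : ℝ × ℝ → ℝ) (z : ℝ × ℝ) : ℝ := fderiv ℝ (Hx H) z (0, 1)
/-- Second partial derivative `H_yy`. -/
def Hyy (H : ℝ × ℝ → ℝ) (z : ℝ × ℝ) : ℝ := fderiv ℝ (Hy H) z (0, 1)

/-- Inequality (★): for all Borel measurable `f, g : ℝⁿ → ℝ` with `(f x, g y) ∈ Ω` for all
`x, y`, one has
`∫ esssup_y H(f((x−y)/a), g(y/b)) dμ(x) ≥ H(∫ f dμ, ∫ g dμ)`,
where the essential supremum in `y` is with respect to Lebesgue measure. -/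
def StarIneq {n : ℕ} (a b : ℝ) (Ω : Set (ℝ × ℝ)) (H : ℝ × ℝ → ℝ)
    (μ : Measure (Euc n)) : Prop :=
  ∀ f g : Euc n → ℝ, Measurable f → Measurable g →
    (∀ x y, (f x, g y) ∈ Ω) →
    H (∫ x, f x ∂μ, ∫ x, g x ∂μ) ≤
      ∫ x, essSup (fun y => H (f (a⁻¹ • (x - y)), g (b⁻¹ • y))) volume ∂μ

open Topology Asymptotics

theorem exists_taylor_two_bound {E : Type*} [NormedAddCommGroup E] [NormedSpace ℝ E]
    {H : E → ℝ} {z : E} (hH : ContDiffAt ℝ 3 H z) :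
    ∃ K ≥ (0 : ℝ), ∀ᶠ d in 𝓝 (0 : E),
      |H (z + d) - H z - fderiv ℝ H z d - fderiv ℝ (fderiv ℝ H) z d d / 2| ≤ K * ‖d‖ ^ 3 := by
  have h1 : ContDiffAt ℝ 2 (fderiv ℝ H) z := hH.fderiv_right (by norm_num)
  have h2 : ContDiffAt ℝ 1 (fderiv ℝ (fderiv ℝ H)) z := h1.fderiv_right (by norm_num)
  have hsymm : IsSymmSndFDerivAt ℝ H z := hH.isSymmSndFDerivAt (by simp; norm_num)
  obtain ⟨K, t, ht, hK⟩ := h2.exists_lipschitzOnWith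
  have e0 : ∀ᶠ x in 𝓝 z, DifferentiableAt ℝ H x :=
    (hH.eventually (by norm_num)).mono fun x hx => hx.differentiableAt (by norm_num)
  have e1 : ∀ᶠ x in 𝓝 z, DifferentiableAt ℝ (fderiv ℝ H) x :=
    (h1.eventually (by norm_num)).mono fun x hx => hx.differentiableAt (by norm_num)
  obtain ⟨δ, hδ, hball⟩ := Metric.eventually_nhds_iff_ball.1 (e0.and (e1.and ht))
  set D := fderiv ℝ (fderiv ℝ H) z with hD
  have first : ∀ d, ‖d‖ < δ → ‖fderiv ℝ H (z + d) - fderiv ℝ H z - D d‖ ≤ K * ‖d‖ ^ 2 := by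
    intro d hd
    have hsub : ∀ e ∈ Metric.closedBall (0 : E) ‖d‖, z + e ∈ Metric.ball z δ := by
      intro e he
      rw [mem_closedBall_zero_iff] at he
      simpa using he.trans_lt hd
    have := (convex_closedBall (0 : E) ‖d‖).norm_image_sub_le_of_norm_hasFDerivWithin_le
      (f := fun e => fderiv ℝ H (z + e) - D e)
      (f' := fun e => fderiv ℝ (fderiv ℝ H) (z + e) - D) (C := K * ‖d‖) (x := 0) (y := d) ?_ ?_
      (by simp) (by simp)
    · simp only [add_zero, map_zero, sub_zero] at this
      rw [sub_right_comm]
      linarith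
    · intro e he
      refine HasFDerivAt.hasFDerivWithinAt ?_
      refine HasFDerivAt.sub ?_ D.hasFDerivAt
      simpa only [hasFDerivWithinAt_univ, Set.vadd_set_univ] using
        (hasFDerivWithinAt_comp_add_left (f := fderiv ℝ H) (s := Set.univ) (x := e) z).2
          ((hball _ (hsub e he)).2.1.hasFDerivAt.hasFDerivWithinAt)
    · intro e he
      have := hK.norm_sub_le (hball _ (hsub e he)).2.2 (mem_of_mem_nhds ht)
      rw [mem_closedBall_zero_iff] at he
      refine this.trans ?_
      rw [add_sub_cancel_left]
      gcongr
  refine ⟨K, K.2, ?_⟩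
  filter_upwards [Metric.ball_mem_nhds (0 : E) hδ] with d hd
  rw [mem_ball_zero_iff] at hd
  have hsub : ∀ e ∈ Metric.closedBall (0 : E) ‖d‖, ‖e‖ < δ := by
    intro e he
    rw [mem_closedBall_zero_iff] at he
    exact he.trans_lt hd
  have := (convex_closedBall (0 : E) ‖d‖).norm_image_sub_le_of_norm_hasFDerivWithin_le
    (f := fun e => H (z + e) - fderiv ℝ H z e - D e e / 2)
    (f' := fun e => fderiv ℝ H (z + e) - fderiv ℝ H z - D e)
    (C := K * ‖d‖ ^ 2) (x := 0) (y := d) ?_ ?_ (by simp) (by simp)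
  · simp only [add_zero, map_zero, sub_zero, zero_div, Real.norm_eq_abs] at this
    refine le_trans (le_of_eq ?_) (this.trans (le_of_eq ?_))
    · congr 1; ring
    · ring
  · intro e he
    refine HasFDerivAt.hasFDerivWithinAt ?_
    have hq : HasFDerivAt (fun e : E => D e e / 2) (D e) e := by
      have := (D.hasFDerivAt (x := e)).clm_apply (hasFDerivAt_id e)
      have := this.mul_const (2⁻¹ : ℝ)
      refine (this.congr_fderiv ?_).congr_of_eventuallyEq (by simp [div_eq_mul_inv])
      ext v
      have := hsymm.eq v e
      simp [← hD] at this ⊢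
      rw [this]; ring
    have hb := hball (z + e) (by simpa using hsub e he)
    have hz : HasFDerivAt (fun x => H (z + x)) (fderiv ℝ H (z + e)) e := by
      simpa only [hasFDerivWithinAt_univ, Set.vadd_set_univ] using
        (hasFDerivWithinAt_comp_add_left (f := H) (s := Set.univ) (x := e) z).2
          hb.1.hasFDerivAt.hasFDerivWithinAt
    exact (hz.sub (fderiv ℝ H z).hasFDerivAt).sub hq
  · intro e he
    refine (first e (hsub e he)).trans ?_
    rw [mem_closedBall_zero_iff] at he
    gcongr


/-- Truncation of the real line to `[-δ, δ]`. -/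
def clamp (δ t : ℝ) : ℝ := max (-δ) (min δ t)

theorem clamp_cases {δ : ℝ} (hδ : 0 < δ) (t : ℝ) :
    (|t| ≤ δ ∧ clamp δ t = t) ∨ (δ < |t| ∧ |clamp δ t| = δ) := by
  unfold clamp
  rcases le_or_gt |t| δ with h | h
  · left
    have := abs_le.1 h
    exact ⟨h, by rw [min_eq_right this.2, max_eq_right this.1]⟩
  · right
    refine ⟨h, ?_⟩
    rcases lt_abs.1 h with h' | h'
    · rw [min_eq_left h'.le, max_eq_right (by linarith), abs_of_pos hδ]
    · rw [min_eq_right (by linarith), max_eq_left (by linarith), abs_neg, abs_of_pos hδ]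

theorem abs_clamp_le {δ : ℝ} (hδ : 0 < δ) (t : ℝ) : |clamp δ t| ≤ δ := by
  rcases clamp_cases hδ t with h | h
  · rw [h.2]; exact h.1
  · exact h.2.le

theorem abs_clamp_sub_clamp_le (δ s t : ℝ) : |clamp δ s - clamp δ t| ≤ |s - t| := by
  unfold clamp
  refine (abs_max_sub_max_le_max _ _ _ _).trans ?_
  refine max_le (by simp) ((abs_min_sub_min_le_max _ _ _ _).trans (max_le (by simp) le_rfl))

theorem clamp_neg {δ : ℝ} (hδ : 0 < δ) (t : ℝ) : clamp δ (-t) = -clamp δ t := by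
  unfold clamp
  rw [max_def, min_def, max_def, min_def]
  split_ifs <;> linarith

theorem abs_clamp_add_clamp_le {δ : ℝ} (hδ : 0 < δ) (s t : ℝ) :
    |clamp δ s + clamp δ t| ≤ |s + t| := by
  have := abs_clamp_sub_clamp_le δ s (-t)
  rwa [clamp_neg hδ, sub_neg_eq_add, sub_neg_eq_add] at this

theorem exists_abs_clamp_add_sq_sub_le {δ : ℝ} (hδ : 0 < δ) (p : ℝ) :
    ∃ K ≥ (0 : ℝ), ∀ t, |clamp δ t + p * clamp δ t ^ 2 - (t + p * t ^ 2)| ≤ K * |t| ^ 3 := by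
  refine ⟨2 / δ ^ 2 + 2 * |p| / δ, by positivity, fun t => ?_⟩
  rcases clamp_cases hδ t with ⟨_, h⟩ | ⟨ht, h⟩
  · rw [h, sub_self, abs_zero]; positivity
  · set c := clamp δ t
    have hc : |c| ≤ |t| := h.le.trans ht.le
    have hc2 : |c| ^ 2 ≤ |t| ^ 2 := by gcongr
    have e : |c + p * c ^ 2 - (t + p * t ^ 2)| ≤ 2 * |t| + 2 * |p| * |t| ^ 2 := by
      calc |c + p * c ^ 2 - (t + p * t ^ 2)| ≤ |c + p * c ^ 2| + |t + p * t ^ 2| := abs_sub _ _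
        _ ≤ (|c| + |p * c ^ 2|) + (|t| + |p * t ^ 2|) := add_le_add (abs_add_le _ _) (abs_add_le _ _)
        _ = (|c| + |p| * |c| ^ 2) + (|t| + |p| * |t| ^ 2) := by simp [abs_mul, abs_pow]
        _ ≤ (|t| + |p| * |t| ^ 2) + (|t| + |p| * |t| ^ 2) := by gcongr
        _ = _ := by ring
    refine e.trans ?_
    have h1 : 1 ≤ |t| / δ := (one_le_div hδ).2 ht.le
    have h2 : 1 ≤ (|t| / δ) ^ 2 := one_le_pow₀ h1
    calc 2 * |t| + 2 * |p| * |t| ^ 2 = 2 * |t| * 1 + 2 * |p| * |t| ^ 2 * 1 := by ring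
      _ ≤ 2 * |t| * (|t| / δ) ^ 2 + 2 * |p| * |t| ^ 2 * (|t| / δ) := by gcongr
      _ = _ := by field_simp

/-- Substituting `r = α + p α²`, `s = β + q β²` in a second-order expansion. -/
theorem exists_expansion_comp {h : ℝ → ℝ → ℝ} {h₀ A B C K δ₀ : ℝ} (hK : 0 ≤ K) (hδ₀ : 0 < δ₀)
    (hh : ∀ r s, |r| ≤ δ₀ → |s| ≤ δ₀ →
      |h r s - (h₀ + r + s + A / 2 * r ^ 2 + B * r * s + C / 2 * s ^ 2)| ≤ K * (|r| + |s|) ^ 3)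
    (p q : ℝ) :
    ∃ K₁ ≥ (0 : ℝ), ∃ δ₁ > 0, ∀ α β, |α| ≤ δ₁ → |β| ≤ δ₁ →
      |α + p * α ^ 2| ≤ δ₀ ∧ |β + q * β ^ 2| ≤ δ₀ ∧
      |h (α + p * α ^ 2) (β + q * β ^ 2) -
        (h₀ + α + β + (A / 2 + p) * α ^ 2 + B * α * β + (C / 2 + q) * β ^ 2)|
        ≤ K₁ * (|α| + |β|) ^ 3 := by
  set δ₁ := min (δ₀ / 2) (1 / (1 + |p| + |q|)) with hδ₁
  have hd0 : δ₁ ≤ δ₀ / 2 := min_le_left _ _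
  have hd1 : δ₁ * (1 + |p| + |q|) ≤ 1 := by
    rw [← le_div_iff₀ (by positivity)]; exact min_le_right _ _
  have hpos : 0 < δ₁ := by positivity
  have key : ∀ p' x : ℝ, |p'| ≤ |p| + |q| → |x| ≤ δ₁ → |x + p' * x ^ 2| ≤ 2 * |x| := by
    intro p' x hp' hx
    have : |p'| * |x| ≤ 1 := by
      calc |p'| * |x| ≤ (|p| + |q|) * δ₁ := by gcongr
        _ ≤ 1 := by linarith
    calc |x + p' * x ^ 2| ≤ |x| + |p'| * |x| * |x| := by
          refine (abs_add_le _ _).trans (le_of_eq ?_)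
          rw [abs_mul, abs_pow]; ring
      _ ≤ |x| + 1 * |x| := by gcongr
      _ = _ := by ring
  refine ⟨8 * K + 2 * |A| * |p| + |B| * (|p| + 2 * |q|) + 2 * |C| * |q|, by positivity, δ₁, hpos, ?_⟩
  intro α β hα hβ
  have hr := key p α (by linarith [abs_nonneg q]) hα
  have hs := key q β (by linarith [abs_nonneg p]) hβ
  have hr' : |α + p * α ^ 2| ≤ δ₀ := by linarith
  have hs' : |β + q * β ^ 2| ≤ δ₀ := by linarith
  refine ⟨hr', hs', ?_⟩
  have h1 := hh _ _ hr' hs'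
  set r := α + p * α ^ 2 with hrdef
  set s := β + q * β ^ 2 with hsdef
  set N := |α| + |β| with hN
  have hN0 : 0 ≤ N := by positivity
  have hαN : |α| ≤ N := by linarith [abs_nonneg β]
  have hβN : |β| ≤ N := by linarith [abs_nonneg α]
  have e1 : K * (|r| + |s|) ^ 3 ≤ 8 * K * N ^ 3 := by
    calc K * (|r| + |s|) ^ 3 ≤ K * (2 * N) ^ 3 := by gcongr; linarith
      _ = _ := by ring
  have hra : |r + α| ≤ 3 * N := (abs_add_le _ _).trans (by linarith)
  have hsb : |s + β| ≤ 3 * N := (abs_add_le _ _).trans (by linarith)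
  have e2 : |A / 2 * ((r - α) * (r + α))| ≤ 2 * |A| * |p| * N ^ 3 := by
    have : r - α = p * α ^ 2 := by rw [hrdef]; ring
    rw [this, abs_mul, abs_mul, abs_mul, abs_pow, abs_div, abs_two]
    calc |A| / 2 * (|p| * |α| ^ 2 * |r + α|) ≤ |A| / 2 * (|p| * N ^ 2 * (3 * N)) := by gcongr
      _ = 3 / 2 * (|A| * |p| * N ^ 3) := by ring
      _ ≤ 2 * (|A| * |p| * N ^ 3) := by gcongr; norm_num
      _ = _ := by ring
  have e3 : |C / 2 * ((s - β) * (s + β))| ≤ 2 * |C| * |q| * N ^ 3 := by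
    have : s - β = q * β ^ 2 := by rw [hsdef]; ring
    rw [this, abs_mul, abs_mul, abs_mul, abs_pow, abs_div, abs_two]
    calc |C| / 2 * (|q| * |β| ^ 2 * |s + β|) ≤ |C| / 2 * (|q| * N ^ 2 * (3 * N)) := by gcongr
      _ = 3 / 2 * (|C| * |q| * N ^ 3) := by ring
      _ ≤ 2 * (|C| * |q| * N ^ 3) := by gcongr; norm_num
      _ = _ := by ring
  have e4 : |B * ((r - α) * β + r * (s - β))| ≤ |B| * (|p| + 2 * |q|) * N ^ 3 := by
    have h1 : r - α = p * α ^ 2 := by rw [hrdef]; ring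
    have h2 : s - β = q * β ^ 2 := by rw [hsdef]; ring
    rw [h1, h2, abs_mul]
    calc |B| * |p * α ^ 2 * β + r * (q * β ^ 2)|
        ≤ |B| * (|p| * |α| ^ 2 * |β| + |r| * (|q| * |β| ^ 2)) := by
          gcongr
          refine (abs_add_le _ _).trans (le_of_eq ?_)
          simp [abs_mul, abs_pow]
      _ ≤ |B| * (|p| * N ^ 2 * N + 2 * N * (|q| * N ^ 2)) := by
          gcongr; linarith
      _ = _ := by ring
  have hsplit : h r s - (h₀ + α + β + (A / 2 + p) * α ^ 2 + B * α * β + (C / 2 + q) * β ^ 2)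
      = (h r s - (h₀ + r + s + A / 2 * r ^ 2 + B * r * s + C / 2 * s ^ 2))
        + A / 2 * ((r - α) * (r + α)) + C / 2 * ((s - β) * (s + β))
        + B * ((r - α) * β + r * (s - β)) := by
    rw [hrdef, hsdef]; ring
  have hsum : (8 * K + 2 * |A| * |p| + |B| * (|p| + 2 * |q|) + 2 * |C| * |q|) * N ^ 3 =
      8 * K * N ^ 3 + 2 * |A| * |p| * N ^ 3 + 2 * |C| * |q| * N ^ 3
        + |B| * (|p| + 2 * |q|) * N ^ 3 := by ring
  rw [hsplit, hsum]
  exact (abs_add_le _ _).trans (add_le_add ((abs_add_le _ _).trans (add_le_add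
    ((abs_add_le _ _).trans (add_le_add (h1.trans e1) e2)) e3)) e4)

theorem abs_add_abs_le_two_mul_abs_sub (t α β : ℝ) :
    |α| + |β| ≤ 2 * |β - t * (α + β)| + (|t| + |1 - t|) * |α + β| := by
  have a1 : |α| ≤ |1 - t| * |α + β| + |β - t * (α + β)| := by
    calc |α| = |(1 - t) * (α + β) - (β - t * (α + β))| := by congr 1; ring
      _ ≤ |(1 - t) * (α + β)| + |β - t * (α + β)| := abs_sub _ _
      _ = _ := by rw [abs_mul]
  have a2 : |β| ≤ |t| * |α + β| + |β - t * (α + β)| := by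
    calc |β| = |t * (α + β) + (β - t * (α + β))| := by congr 1; ring
      _ ≤ |t * (α + β)| + |β - t * (α + β)| := abs_add_le _ _
      _ = _ := by rw [abs_mul]
  linarith

/-- A strictly negative square absorbs the part of the cubic error transversal to `α + β`. -/
theorem exists_absorb_cubic_error {G : ℝ → ℝ → ℝ} {h₀ B K₁ δ₁ l t : ℝ} (hK₁ : 0 ≤ K₁)
    (hδ₁ : 0 < δ₁) (hl : 0 < l)
    (hG : ∀ α β, |α| ≤ δ₁ → |β| ≤ δ₁ →
      G α β ≤ h₀ + α + β + B / 2 * (α + β) ^ 2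
        - l * (t * α ^ 2 + (1 - t) * β ^ 2) + K₁ * (|α| + |β|) ^ 3) :
    ∃ δ > 0, δ ≤ δ₁ ∧ ∃ K ≥ (0 : ℝ), ∀ α β, |α| ≤ δ → |β| ≤ δ →
      G α β ≤ h₀ + (α + β) + (B / 2 - l * (t * (1 - t))) * (α + β) ^ 2
      - l / 2 * (β - t * (α + β)) ^ 2 + K * |α + β| ^ 3 := by
  have hδpos : 0 < min δ₁ (l / (64 * (K₁ + 1) * (1 + 2 * |t|))) := by positivity
  have hδs : 32 * K₁ * (min δ₁ (l / (64 * (K₁ + 1) * (1 + 2 * |t|))) * (1 + 2 * |t|)) ≤ l / 2 := by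
    have h1 := min_le_right δ₁ (l / (64 * (K₁ + 1) * (1 + 2 * |t|)))
    rw [le_div_iff₀ (by positivity)] at h1
    have : 0 ≤ min δ₁ (l / (64 * (K₁ + 1) * (1 + 2 * |t|))) * (1 + 2 * |t|) := by positivity
    nlinarith
  have hδle := min_le_left δ₁ (l / (64 * (K₁ + 1) * (1 + 2 * |t|)))
  generalize min δ₁ (l / (64 * (K₁ + 1) * (1 + 2 * |t|))) = δ at hδpos hδs hδle
  refine ⟨δ, hδpos, hδle, 4 * K₁ * (|t| + |1 - t|) ^ 3, by positivity, fun α β hα hβ => ?_⟩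
  have h1 := hG α β (hα.trans hδle) (hβ.trans hδle)
  have hN := abs_add_abs_le_two_mul_abs_sub t α β
  have hw2 : |α + β| ≤ 2 * δ := (abs_add_le _ _).trans (by linarith)
  have hquad : B / 2 * (α + β) ^ 2 - l * (t * α ^ 2 + (1 - t) * β ^ 2) =
      (B / 2 - l * (t * (1 - t))) * (α + β) ^ 2 - l * (β - t * (α + β)) ^ 2 := by ring
  have hesmall : |β - t * (α + β)| ≤ δ * (1 + 2 * |t|) := by
    calc |β - t * (α + β)| ≤ |β| + |t| * |α + β| := by rw [← abs_mul]; exact abs_sub _ _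
      _ ≤ δ + |t| * (2 * δ) := by gcongr
      _ = _ := by ring
  have hT : 0 ≤ |t| + |1 - t| := by positivity
  have hlin : h₀ + α + β = h₀ + (α + β) := by ring
  rw [hlin] at h1
  generalize α + β = w at *
  generalize β - t * w = e at *
  generalize |t| + |1 - t| = T at *
  have hcube : (|α| + |β|) ^ 3 ≤ 32 * |e| ^ 3 + 4 * T ^ 3 * |w| ^ 3 := by
    calc (|α| + |β|) ^ 3 ≤ (2 * |e| + T * |w|) ^ 3 := by gcongr
      _ ≤ 2 ^ (3 - 1) * ((2 * |e|) ^ 3 + (T * |w|) ^ 3) :=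
          add_pow_le (by positivity) (by positivity) 3
      _ = _ := by ring
  have hcub : K₁ * (32 * |e| ^ 3) ≤ l / 2 * e ^ 2 := by
    calc K₁ * (32 * |e| ^ 3) = 32 * K₁ * |e| * |e| ^ 2 := by ring
      _ ≤ 32 * K₁ * (δ * (1 + 2 * |t|)) * |e| ^ 2 := by gcongr
      _ ≤ l / 2 * |e| ^ 2 := by gcongr
      _ = _ := by rw [sq_abs]
  have hK : K₁ * (|α| + |β|) ^ 3 ≤ l / 2 * e ^ 2 + 4 * K₁ * T ^ 3 * |w| ^ 3 := by
    calc K₁ * (|α| + |β|) ^ 3 ≤ K₁ * (32 * |e| ^ 3 + 4 * T ^ 3 * |w| ^ 3) := by gcongr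
      _ = K₁ * (32 * |e| ^ 3) + 4 * K₁ * T ^ 3 * |w| ^ 3 := by ring
      _ ≤ _ := by gcongr
  linarith

/-- Upper bound for the supremum of the truncated second-order expansion. -/
theorem exists_clamp_upper_bound {G : ℝ → ℝ → ℝ} {h₀ B K₁ δ₁ l t : ℝ} (hK₁ : 0 ≤ K₁)
    (hδ₁ : 0 < δ₁) (hl : 0 < l)
    (hG : ∀ α β, |α| ≤ δ₁ → |β| ≤ δ₁ →
      G α β ≤ h₀ + α + β + B / 2 * (α + β) ^ 2
        - l * (t * α ^ 2 + (1 - t) * β ^ 2) + K₁ * (|α| + |β|) ^ 3) :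
    ∃ δ > 0, δ ≤ δ₁ ∧ ∃ K ≥ (0 : ℝ), ∀ X Y, G (clamp δ (X - Y)) (clamp δ Y) ≤
      h₀ + X + (B / 2 - l * (t * (1 - t))) * X ^ 2 + K * |X| ^ 3 := by
  obtain ⟨δ, hδpos, hδle, K₂, hK₂, core⟩ := exists_absorb_cubic_error hK₁ hδ₁ hl hG
  generalize B / 2 - l * (t * (1 - t)) = S at core ⊢
  obtain ⟨D, hD, hD0⟩ : ∃ D, D = l * δ ^ 2 / 32 ∧ 0 < D := ⟨_, rfl, by positivity⟩
  have hT0 : 0 < |t| + |1 - t| := by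
    have : |t + (1 - t)| ≤ |t| + |1 - t| := abs_add_le _ _
    rw [add_sub_cancel, abs_one] at this
    linarith
  -- the range of `X` on which the truncated region is harmless
  obtain ⟨c, hc0, hc1, hcT, hcD⟩ : ∃ c > 0, c ≤ 1 ∧ (|t| + |1 - t|) * c ≤ δ / 2 ∧
      (2 + 2 * |S|) * c ≤ D := by
    refine ⟨min 1 (min (δ / (2 * (|t| + |1 - t|))) (D / (2 + 2 * |S|))), by positivity,
      min_le_left _ _, ?_, ?_⟩
    · have := (min_le_right 1 (min (δ / (2 * (|t| + |1 - t|))) (D / (2 + 2 * |S|)))).trans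
        (min_le_left _ _)
      rw [le_div_iff₀ (by positivity)] at this
      linarith
    · have := (min_le_right 1 (min (δ / (2 * (|t| + |1 - t|))) (D / (2 + 2 * |S|)))).trans
        (min_le_right _ _)
      rw [le_div_iff₀ (by positivity)] at this
      linarith
  obtain ⟨M, hM⟩ : ∃ M, M = 2 * δ + |S| * (2 * δ) ^ 2 := ⟨_, rfl⟩
  have hM0 : 0 ≤ M := by rw [hM]; positivity
  refine ⟨δ, hδpos, hδle, K₂ + (M / c ^ 3 + 1 / c ^ 2 + |S| / c), by positivity, ?_⟩
  intro X Y
  have hα := abs_clamp_le hδpos (X - Y)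
  have hβ := abs_clamp_le hδpos Y
  have hwX : |clamp δ (X - Y) + clamp δ Y| ≤ |X| := by
    simpa using abs_clamp_add_clamp_le hδpos (X - Y) Y
  have h1 := core _ _ hα hβ
  have hcases : clamp δ (X - Y) + clamp δ Y = X ∨ δ ≤ |clamp δ (X - Y)| + |clamp δ Y| := by
    rcases clamp_cases hδpos (X - Y) with h2 | h2
    · rcases clamp_cases hδpos Y with h3 | h3
      · left; rw [h2.2, h3.2]; ring
      · right; linarith [h3.2, abs_nonneg (clamp δ (X - Y))]
    · right; linarith [h2.2, abs_nonneg (clamp δ Y)]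
  have hN := abs_add_abs_le_two_mul_abs_sub t (clamp δ (X - Y)) (clamp δ Y)
  have hw2 : |clamp δ (X - Y) + clamp δ Y| ≤ 2 * δ := (abs_add_le _ _).trans (by linarith)
  generalize clamp δ (X - Y) = α at *
  generalize clamp δ Y = β at *
  generalize hw : α + β = w at *
  generalize β - t * w = e at *
  generalize |t| + |1 - t| = T at *
  have hwcube : K₂ * |w| ^ 3 ≤ K₂ * |X| ^ 3 := by gcongr
  have hextra : 0 ≤ (M / c ^ 3 + 1 / c ^ 2 + |S| / c) * |X| ^ 3 := by positivity
  have hSX : -(|S| * |X| ^ 2) ≤ S * X ^ 2 := by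
    rw [← sq_abs X]; nlinarith [neg_abs_le S, sq_nonneg |X|]
  have hSw : S * w ^ 2 ≤ |S| * |w| ^ 2 := by
    rw [← sq_abs w]; nlinarith [le_abs_self S, sq_nonneg |w|]
  have hle : 0 ≤ l / 2 * e ^ 2 := by positivity
  have hXneg := neg_abs_le X
  have hwle := le_abs_self w
  rcases le_or_gt |X| c with hXc | hXc
  · rw [add_mul]
    rcases hcases with rfl | hN'
    · linarith
    · have hTw : T * |w| ≤ δ / 2 := by
        calc T * |w| ≤ T * c := by gcongr; exact hwX.trans hXc
          _ ≤ _ := hcT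
      have hebig : δ / 4 ≤ |e| := by linarith
      have hDe : D ≤ l / 2 * e ^ 2 := by
        calc D = l / 2 * (δ / 4) ^ 2 := by rw [hD]; ring
          _ ≤ l / 2 * |e| ^ 2 := by gcongr
          _ = _ := by rw [sq_abs]
      have hX2 : |X| ^ 2 ≤ c := by
        calc |X| ^ 2 ≤ c ^ 2 := by gcongr
          _ ≤ c := by nlinarith
      have hX22 : |S| * |X| ^ 2 ≤ |S| * c := by gcongr
      have hw22 : |S| * |w| ^ 2 ≤ |S| * |X| ^ 2 := by gcongr
      linarith
  · have hq : 1 ≤ |X| / c := (one_le_div hc0).2 hXc.le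
    have b1 : M ≤ M / c ^ 3 * |X| ^ 3 := by
      calc M = M * 1 := by ring
        _ ≤ M * (|X| / c) ^ 3 := by gcongr; exact one_le_pow₀ hq
        _ = _ := by field_simp
    have b2 : |X| ≤ 1 / c ^ 2 * |X| ^ 3 := by
      calc |X| = |X| * 1 := by ring
        _ ≤ |X| * (|X| / c) ^ 2 := by gcongr; exact one_le_pow₀ hq
        _ = _ := by field_simp
    have b3 : |S| * |X| ^ 2 ≤ |S| / c * |X| ^ 3 := by
      calc |S| * |X| ^ 2 = |S| * |X| ^ 2 * 1 := by ring
        _ ≤ |S| * |X| ^ 2 * (|X| / c) := by gcongr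
        _ = _ := by field_simp
    have b4 : |S| * |w| ^ 2 ≤ |S| * (2 * δ) ^ 2 := by gcongr
    rw [add_mul, add_mul, add_mul]
    linarith

/-- A quadratic polynomial without constant term that is nonnegative near `0` up to a cubic error
has zero linear and nonnegative quadratic coefficient. -/
theorem eq_zero_and_nonneg_of_nonneg_add_isBigO {c₁ c₂ : ℝ} {E : ℝ → ℝ}
    (hE : E =O[𝓝 0] fun ε => ε ^ 3) (h : ∀ᶠ ε in 𝓝 0, 0 ≤ c₁ * ε + c₂ * ε ^ 2 + E ε) :
    c₁ = 0 ∧ 0 ≤ c₂ := by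
  obtain ⟨K, hK0, hK⟩ := hE.exists_pos
  rw [IsBigOWith] at hK
  have key : ∀ᶠ ε in 𝓝 (0 : ℝ), 0 ≤ c₁ * ε + c₂ * ε ^ 2 + K * |ε| ^ 3 := by
    filter_upwards [h, hK] with ε h1 h2
    have := le_abs_self (E ε)
    simp only [norm_eq_abs, abs_pow] at h2
    linarith
  have keypos : ∀ᶠ ε in 𝓝[>] (0 : ℝ), 0 ≤ c₁ + c₂ * ε + K * ε ^ 2 := by
    filter_upwards [nhdsWithin_le_nhds key, self_mem_nhdsWithin] with ε h1 h2
    rw [abs_of_pos h2] at h1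
    refine nonneg_of_mul_nonneg_right (a := ε) ?_ h2
    linarith
  have keyneg : ∀ᶠ ε in 𝓝[<] (0 : ℝ), 0 ≤ -c₁ - c₂ * ε + K * ε ^ 2 := by
    filter_upwards [nhdsWithin_le_nhds key, self_mem_nhdsWithin] with ε h1 h2
    rw [abs_of_neg h2] at h1
    refine nonneg_of_mul_nonneg_right (a := -ε) ?_ (neg_pos.2 h2)
    linarith
  have t1 : Tendsto (fun ε : ℝ => c₁ + c₂ * ε + K * ε ^ 2) (𝓝[>] 0) (𝓝 c₁) := by
    refine tendsto_nhdsWithin_of_tendsto_nhds ?_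
    have : Continuous fun ε : ℝ => c₁ + c₂ * ε + K * ε ^ 2 := by fun_prop
    simpa using this.tendsto 0
  have t2 : Tendsto (fun ε : ℝ => -c₁ - c₂ * ε + K * ε ^ 2) (𝓝[<] 0) (𝓝 (-c₁)) := by
    refine tendsto_nhdsWithin_of_tendsto_nhds ?_
    have : Continuous fun ε : ℝ => -c₁ - c₂ * ε + K * ε ^ 2 := by fun_prop
    simpa using this.tendsto 0
  have hc : c₁ = 0 := by
    have h1 := ge_of_tendsto t1 keypos
    have h2 := ge_of_tendsto t2 keyneg
    linarith
  refine ⟨hc, ?_⟩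
  subst hc
  have t3 : Tendsto (fun ε : ℝ => c₂ + K * ε) (𝓝[>] 0) (𝓝 c₂) := by
    refine tendsto_nhdsWithin_of_tendsto_nhds ?_
    have : Continuous fun ε : ℝ => c₂ + K * ε := by fun_prop
    simpa using this.tendsto 0
  refine ge_of_tendsto t3 ?_
  filter_upwards [keypos, self_mem_nhdsWithin] with ε h1 h2
  refine nonneg_of_mul_nonneg_right (a := ε) ?_ h2
  linarith

theorem isBigO_pow_of_le {k l : ℕ} (h : l ≤ k) :
    (fun ε : ℝ => ε ^ k) =O[𝓝 0] fun ε => ε ^ l := by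
  refine IsBigO.of_bound 1 ?_
  filter_upwards [Metric.ball_mem_nhds (0 : ℝ) one_pos] with ε hε
  rw [mem_ball_zero_iff] at hε
  rw [one_mul, norm_pow, norm_pow]
  exact pow_le_pow_of_le_one (norm_nonneg _) hε.le h

theorem isBigO_mul_sub_mul {r s : ℝ → ℝ} {r₁ s₁ : ℝ}
    (hr : (fun ε => r ε - r₁ * ε) =O[𝓝 0] fun ε => ε ^ 2)
    (hs : (fun ε => s ε - s₁ * ε) =O[𝓝 0] fun ε => ε ^ 2) :
    (fun ε => r ε * s ε - r₁ * s₁ * ε ^ 2) =O[𝓝 0] fun ε => ε ^ 3 := by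
  have hid : (fun ε : ℝ => r₁ * ε) =O[𝓝 0] fun ε => ε ^ 1 := by
    simpa using (isBigO_refl (fun ε : ℝ => ε) (𝓝 0)).const_mul_left r₁
  have hs' : s =O[𝓝 0] fun ε => ε ^ 1 := by
    have h1 := (hs.trans (isBigO_pow_of_le one_le_two)).add
      (show (fun ε : ℝ => s₁ * ε) =O[𝓝 0] fun ε => ε ^ 1 by
        simpa using (isBigO_refl (fun ε : ℝ => ε) (𝓝 0)).const_mul_left s₁)
    simpa using h1
  have h1 := hr.mul hs'
  have h2 := hid.mul hs
  have h1' : (fun ε => (r ε - r₁ * ε) * s ε) =O[𝓝 0] fun ε => ε ^ 3 :=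
    h1.congr_right fun ε => by ring
  have h2' : (fun ε => r₁ * ε * (s ε - s₁ * ε)) =O[𝓝 0] fun ε => ε ^ 3 :=
    h2.congr_right fun ε => by ring
  exact (h1'.add h2').congr_left fun ε => by ring

/-- Comparison of second-order coefficients along a curve `ε ↦ (r ε, s ε)`. -/
theorem coeff_comparison {h : ℝ → ℝ → ℝ} {h₀ A B C K δ₀ : ℝ} (hδ₀ : 0 < δ₀)
    (hh : ∀ r s, |r| ≤ δ₀ → |s| ≤ δ₀ →
      |h r s - (h₀ + r + s + A / 2 * r ^ 2 + B * r * s + C / 2 * s ^ 2)| ≤ K * (|r| + |s|) ^ 3)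
    {r s : ℝ → ℝ} {r₁ r₂ s₁ s₂ m V L : ℝ}
    (hr : (fun ε => r ε - (r₁ * ε + r₂ * ε ^ 2)) =O[𝓝 0] fun ε => ε ^ 3)
    (hs : (fun ε => s ε - (s₁ * ε + s₂ * ε ^ 2)) =O[𝓝 0] fun ε => ε ^ 3)
    (hle : ∀ ε, h (r ε) (s ε) ≤ h₀ + m * ε + V * ε ^ 2 + L * |ε| ^ 3) :
    m - (r₁ + s₁) = 0 ∧
      0 ≤ V - (r₂ + s₂ + A / 2 * r₁ ^ 2 + B * (r₁ * s₁) + C / 2 * s₁ ^ 2) := by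
  have lin : ∀ {r : ℝ → ℝ} {r₁ r₂ : ℝ},
      ((fun ε => r ε - (r₁ * ε + r₂ * ε ^ 2)) =O[𝓝 0] fun ε => ε ^ 3) →
      (fun ε => r ε - r₁ * ε) =O[𝓝 0] fun ε => ε ^ 2 := by
    intro r r₁ r₂ hr
    have := (hr.trans (isBigO_pow_of_le (show 2 ≤ 3 by norm_num))).add
      ((isBigO_refl (fun ε : ℝ => ε ^ 2) (𝓝 0)).const_mul_left r₂)
    exact this.congr_left fun ε => by ring
  have bigO1 : ∀ {r : ℝ → ℝ} {r₁ : ℝ},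
      ((fun ε => r ε - r₁ * ε) =O[𝓝 0] fun ε => ε ^ 2) →
      r =O[𝓝 0] fun ε : ℝ => ε := by
    intro r r₁ hr
    have := (hr.trans (isBigO_pow_of_le one_le_two)).add
      (show (fun ε : ℝ => r₁ * ε) =O[𝓝 0] fun ε => ε ^ 1 by
        simpa using (isBigO_refl (fun ε : ℝ => ε) (𝓝 0)).const_mul_left r₁)
    simpa using this
  have hr1 := lin hr
  have hs1 := lin hs
  have hrO := bigO1 hr1
  have hsO := bigO1 hs1
  have tr : Tendsto r (𝓝 0) (𝓝 0) := hrO.trans_tendsto tendsto_id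
  have ts : Tendsto s (𝓝 0) (𝓝 0) := hsO.trans_tendsto tendsto_id
  have small : ∀ {r : ℝ → ℝ}, Tendsto r (𝓝 0) (𝓝 0) → ∀ᶠ ε in 𝓝 (0 : ℝ), |r ε| ≤ δ₀ := by
    intro r tr
    filter_upwards [tr (Metric.closedBall_mem_nhds 0 hδ₀)] with ε hε
    simpa using hε
  have hcub : (fun ε => K * (|r ε| + |s ε|) ^ 3 + L * |ε| ^ 3) =O[𝓝 0] fun ε : ℝ => ε ^ 3 := by
    have h1 := (((hrO.norm_left).add (hsO.norm_left)).pow 3).const_mul_left K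
    have h2 := ((isBigO_refl (fun ε : ℝ => ε) (𝓝 0)).norm_left.pow 3).const_mul_left L
    exact h1.add h2
  have hE := (((((hr.add hs).add ((isBigO_mul_sub_mul hr1 hr1).const_mul_left (A / 2))).add
    ((isBigO_mul_sub_mul hr1 hs1).const_mul_left B)).add
    ((isBigO_mul_sub_mul hs1 hs1).const_mul_left (C / 2))).neg_left).add hcub
  refine eq_zero_and_nonneg_of_nonneg_add_isBigO hE ?_
  filter_upwards [small tr, small ts] with ε h1 h2
  have h3 := (abs_le.1 (hh _ _ h1 h2)).1
  have h4 := hle ε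
  linarith

theorem integrable_abs_coord_pow {n : ℕ} {μ : Measure (Euc n)} [IsProbabilityMeasure μ]
    (hmom : Integrable (fun x : Euc n => ‖x‖ ^ 5) μ) (i : Fin n) {k : ℕ} (hk : k ≤ 5) :
    Integrable (fun x : Euc n => |x i| ^ k) μ := by
  refine ((integrable_const (1 : ℝ)).add hmom).mono' (by fun_prop) (ae_of_all _ fun x => ?_)
  have h1 : |x i| ≤ ‖x‖ := PiLp.norm_apply_le x i
  have h2 : |x i| ^ k ≤ ‖x‖ ^ k := by gcongr
  simp only [norm_pow, norm_eq_abs, abs_abs, Pi.add_apply]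
  refine h2.trans ?_
  rcases le_total ‖x‖ 1 with h | h
  · have := pow_le_one₀ (n := k) (norm_nonneg x) h
    have := pow_nonneg (norm_nonneg x) 5
    linarith
  · have := pow_le_pow_right₀ h hk
    linarith

theorem integrable_coord {n : ℕ} {μ : Measure (Euc n)} [IsProbabilityMeasure μ]
    (hmom : Integrable (fun x : Euc n => ‖x‖ ^ 5) μ) (i : Fin n) :
    Integrable (fun x : Euc n => x i) μ := by
  have := integrable_abs_coord_pow hmom i (k := 1) (by norm_num)
  simp only [pow_one] at this
  exact (integrable_norm_iff (f := fun x : Euc n => x i)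
    (by fun_prop)).1 this

theorem integrable_coord_sq {n : ℕ} {μ : Measure (Euc n)} [IsProbabilityMeasure μ]
    (hmom : Integrable (fun x : Euc n => ‖x‖ ^ 5) μ) (i : Fin n) :
    Integrable (fun x : Euc n => x i ^ 2) μ := by
  simpa only [sq_abs] using integrable_abs_coord_pow hmom i (k := 2) (by norm_num)

theorem variance_coord_pos {n : ℕ} {μ : Measure (Euc n)} [IsProbabilityMeasure μ]
    (hac : μ ≪ volume) (hmom : Integrable (fun x : Euc n => ‖x‖ ^ 5) μ) (i : Fin n) :
    0 < ∫ x, x i ^ 2 ∂μ - (∫ x, x i ∂μ) ^ 2 := by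
  have h1 := integrable_coord hmom i
  have h2 := integrable_coord_sq hmom i
  set m := ∫ x, x i ∂μ with hm
  have hexp : ∀ x : Euc n, (x i - m) ^ 2 = x i ^ 2 - 2 * m * x i + m ^ 2 := fun x => by ring
  have hint : Integrable (fun x : Euc n => (x i - m) ^ 2) μ := by
    simp only [hexp]
    exact (h2.sub (h1.const_mul _)).add (integrable_const _)
  have heq : ∫ x, (x i - m) ^ 2 ∂μ = ∫ x, x i ^ 2 ∂μ - m ^ 2 := by
    simp only [hexp]
    have hsub : Integrable (fun x : Euc n => x i ^ 2 - 2 * m * x i) μ := h2.sub (h1.const_mul _)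
    rw [integral_add hsub (integrable_const _),
      integral_sub h2 (h1.const_mul _), integral_const_mul, ← hm]
    simp
    ring
  rw [← heq]
  refine (integral_nonneg fun x => sq_nonneg _).lt_of_ne' fun h0 => ?_
  rw [integral_eq_zero_iff_of_nonneg (fun x => sq_nonneg _) hint] at h0
  have hset : volume {x : Euc n | x i = m} = 0 := by
    have e := (EuclideanSpace.volume_preserving_symm_measurableEquiv_toLp (Fin n)).symm
    rw [← e.measure_preimage_equiv]
    exact Measure.pi_hyperplane (fun _ : Fin n => (volume : Measure ℝ)) i m
  have hμ : ∀ᵐ x ∂μ, x i ≠ m := by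
    have := hac hset
    rw [ae_iff]
    simpa using this
  have : ∀ᵐ x ∂μ, False := by
    filter_upwards [h0, hμ] with x hx hx'
    exact hx' (by simpa [sub_eq_zero] using hx)
  simp at this
  exact IsProbabilityMeasure.ne_zero μ this

theorem essSup_le_of_forall_le {α : Type*} [MeasurableSpace α] {ν : Measure α} [NeZero ν]
    {F : α → ℝ} {M c : ℝ} (hM : ∀ y, -M ≤ F y) (hc : ∀ y, F y ≤ c) : essSup F ν ≤ c := by
  refine essSup_le_of_ae_le c (ae_of_all _ hc) ?_
  exact IsBoundedUnder.isCoboundedUnder_le ⟨-M, by simpa using ae_of_all _ hM⟩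

theorem essSup_le_essSup_sub {α : Type*} [MeasurableSpace α] {ν : Measure α} [NeZero ν]
    {F G : α → ℝ} {M M' c : ℝ} (hM : ∀ y, -M' ≤ F y) (hG : ∀ y, G y ≤ M)
    (h : ∀ y, F y + c ≤ G y) : essSup F ν ≤ essSup G ν - c := by
  have hae : ∀ᵐ y ∂ν, G y ≤ essSup G ν :=
    ae_le_essSup ⟨M, by simpa using ae_of_all _ hG⟩
  refine essSup_le_of_ae_le _ ?_ ?_
  · filter_upwards [hae] with y hy
    linarith [h y]
  · exact IsBoundedUnder.isCoboundedUnder_le ⟨-M', by simpa using ae_of_all _ hM⟩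

/-- The essential supremum over a parameter in which the family is uniformly bounded and
equicontinuous is continuous. -/
theorem continuous_essSup {X α : Type*} [TopologicalSpace X] [MeasurableSpace α] {ν : Measure α}
    [NeZero ν] {F : X → α → ℝ} {M : ℝ} (hM : ∀ x y, |F x y| ≤ M)
    (hF : Equicontinuous fun y x => F x y) : Continuous fun x => essSup (F x) ν := by
  refine continuous_iff_continuousAt.2 fun x => ?_
  refine Metric.tendsto_nhds.2 fun ε hε => ?_
  filter_upwards [Metric.equicontinuousAt_iff_right.1 (hF x) (ε / 2) (half_pos hε)] with x' hx'
  have hd : ∀ y, |F x y - F x' y| < ε / 2 := fun y => by simpa [Real.dist_eq] using hx' y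
  have l := fun x y => (abs_le.1 (hM x y)).1
  have u := fun x y => (abs_le.1 (hM x y)).2
  have h1 := essSup_le_essSup_sub (ν := ν) (c := -(ε / 2)) (l x) (u x') fun y => by
    linarith [(abs_lt.1 (hd y)).2]
  have h2 := essSup_le_essSup_sub (ν := ν) (c := -(ε / 2)) (l x') (u x) fun y => by
    linarith [(abs_lt.1 (hd y)).1]
  rw [Real.dist_eq, abs_lt]
  constructor <;> linarith

theorem integrable_essSup {X α : Type*} [TopologicalSpace X] [MeasurableSpace X] [BorelSpace X]
    [MeasurableSpace α] {ν : Measure α} [NeZero ν] {μ : Measure X} [IsFiniteMeasure μ]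
    {F : X → α → ℝ} {M : ℝ} (hM : ∀ x y, |F x y| ≤ M) (hF : Equicontinuous fun y x => F x y) :
    Integrable (fun x => essSup (F x) ν) μ := by
  refine Integrable.of_bound (continuous_essSup hM hF).measurable.aestronglyMeasurable M
    (ae_of_all _ fun x => ?_)
  have l := fun y => (abs_le.1 (hM x y)).1
  have u := fun y => (abs_le.1 (hM x y)).2
  rw [norm_eq_abs, abs_le]
  refine ⟨?_, essSup_le_of_forall_le l u⟩
  have := essSup_le_essSup_sub (ν := ν) (F := fun _ => -M) (c := 0) (fun _ => le_rfl) u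
    fun y => by linarith [l y]
  rwa [essSup_const', sub_zero] at this

theorem exists_local_expansion {P Q : ℝ × ℝ} {H : ℝ × ℝ → ℝ}
    (hH : ContDiffOn ℝ 3 H (Set.Icc P Q)) {z : ℝ × ℝ} (hz : z ∈ interior (Set.Icc P Q))
    (hx : Hx H z ≠ 0) (hy : Hy H z ≠ 0) :
    ∃ K ≥ (0 : ℝ), ∃ δ₀ > 0, ∀ r s, |r| ≤ δ₀ → |s| ≤ δ₀ →
      (z.1 + r / Hx H z, z.2 + s / Hy H z) ∈ Set.Icc P Q ∧
      |H (z.1 + r / Hx H z, z.2 + s / Hy H z) - (H z + r + s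
        + Hxx H z / Hx H z ^ 2 / 2 * r ^ 2 + Hxy H z / (Hx H z * Hy H z) * r * s
        + Hyy H z / Hy H z ^ 2 / 2 * s ^ 2)| ≤ K * (|r| + |s|) ^ 3 := by
  have hnhds : Set.Icc P Q ∈ 𝓝 z := mem_interior_iff_mem_nhds.1 hz
  have hHz : ContDiffAt ℝ 3 H z := hH.contDiffAt hnhds
  obtain ⟨K, hK0, hK⟩ := exists_taylor_two_bound hHz
  have hmem : ∀ᶠ d in 𝓝 (0 : ℝ × ℝ), z + d ∈ Set.Icc P Q := by
    have : Tendsto (fun d : ℝ × ℝ => z + d) (𝓝 0) (𝓝 z) := by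
      simpa using (continuous_const.add continuous_id).tendsto (f := fun d : ℝ × ℝ => z + d) 0
    exact this hnhds
  obtain ⟨η, hη, hball⟩ := Metric.eventually_nhds_iff_ball.1 (hK.and hmem)
  have hdiff : DifferentiableAt ℝ (fderiv ℝ H) z :=
    (hHz.fderiv_right (m := 2) (by norm_num)).differentiableAt (by norm_num)
  have hsymm : IsSymmSndFDerivAt ℝ H z := hHz.isSymmSndFDerivAt (by simp; norm_num)
  have hsecond : ∀ v w : ℝ × ℝ,
      fderiv ℝ (fun y => fderiv ℝ H y v) z w = fderiv ℝ (fderiv ℝ H) z w v := by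
    intro v w
    rw [(hdiff.hasFDerivAt.clm_apply (hasFDerivAt_const v z)).fderiv]
    simp
  have hxx : fderiv ℝ (fderiv ℝ H) z (1, 0) (1, 0) = Hxx H z := (hsecond _ _).symm
  have hyx : fderiv ℝ (fderiv ℝ H) z (0, 1) (1, 0) = Hxy H z := (hsecond _ _).symm
  have hyy : fderiv ℝ (fderiv ℝ H) z (0, 1) (0, 1) = Hyy H z := (hsecond _ _).symm
  have hxy : fderiv ℝ (fderiv ℝ H) z (1, 0) (0, 1) = Hxy H z := (hsymm.eq _ _).trans hyx
  have hpx : fderiv ℝ H z (1, 0) = Hx H z := rfl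
  have hpy : fderiv ℝ H z (0, 1) = Hy H z := rfl
  generalize Hx H z = p at *
  generalize Hy H z = q at *
  have hp := abs_pos.2 hx
  have hq := abs_pos.2 hy
  refine ⟨K * (1 / |p| + 1 / |q|) ^ 3, by positivity, min (η * |p| / 2) (η * |q| / 2),
    by positivity, fun r s hr hs => ?_⟩
  have hd : z + (r / p, s / q) = (z.1 + r / p, z.2 + s / q) := rfl
  have hr1 : |r / p| ≤ η / 2 := by
    rw [abs_div, div_le_iff₀ hp]
    linarith [hr.trans (min_le_left _ _)]
  have hs1 : |s / q| ≤ η / 2 := by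
    rw [abs_div, div_le_iff₀ hq]
    linarith [hs.trans (min_le_right _ _)]
  have hin : (r / p, s / q) ∈ Metric.ball (0 : ℝ × ℝ) η := by
    rw [mem_ball_zero_iff, Prod.norm_mk]
    exact max_lt (hr1.trans_lt (by linarith)) (hs1.trans_lt (by linarith))
  obtain ⟨h1, h2⟩ := hball _ hin
  rw [hd] at h1 h2
  refine ⟨h2, ?_⟩
  have hdec : ((r / p, s / q) : ℝ × ℝ) = (r / p) • (1, 0) + (s / q) • (0, 1) := by
    simp
  have e1 : fderiv ℝ H z (r / p, s / q) = r + s := by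
    rw [hdec, map_add, map_smul, map_smul, hpx, hpy, smul_eq_mul, smul_eq_mul,
      div_mul_cancel₀ _ hx, div_mul_cancel₀ _ hy]
  have e2 : fderiv ℝ (fderiv ℝ H) z (r / p, s / q) (r / p, s / q) / 2 =
      Hxx H z / p ^ 2 / 2 * r ^ 2 + Hxy H z / (p * q) * r * s + Hyy H z / q ^ 2 / 2 * s ^ 2 := by
    rw [hdec]
    simp only [map_add, map_smul, add_apply, smul_apply,
      hxx, hyx, hxy, hyy, smul_eq_mul]
    field_simp
    ring
  have hnorm : ‖((r / p, s / q) : ℝ × ℝ)‖ ≤ (1 / |p| + 1 / |q|) * (|r| + |s|) := by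
    have hr' : 0 ≤ |r| * (1 / |q|) := by positivity
    have hs' : 0 ≤ |s| * (1 / |p|) := by positivity
    have hr'' : 0 ≤ |r| * (1 / |p|) := by positivity
    have hs'' : 0 ≤ |s| * (1 / |q|) := by positivity
    rw [Prod.norm_mk]
    refine max_le ?_ ?_
    · rw [norm_eq_abs, abs_div, div_eq_mul_one_div]
      linarith
    · rw [norm_eq_abs, abs_div, div_eq_mul_one_div]
      linarith
  rw [e1, e2] at h1
  calc _ = _ := by congr 1; ring
    _ ≤ _ := h1
    _ ≤ K * ((1 / |p| + 1 / |q|) * (|r| + |s|)) ^ 3 := by gcongr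
    _ = _ := by ring

theorem integrable_essSup_comp {n : ℕ} {μ : Measure (Euc n)} [IsProbabilityMeasure μ]
    {s : Set (ℝ × ℝ)} (hs : IsCompact s) {H : ℝ × ℝ → ℝ} (hH : ContinuousOn H s)
    {f g : Euc n → ℝ} (hf : UniformContinuous f) (hfg : ∀ x y, (f x, g y) ∈ s) (a b : ℝ) :
    Integrable (fun x => essSup (fun y => H (f (a⁻¹ • (x - y)), g (b⁻¹ • y))) volume) μ := by
  obtain ⟨M, hM⟩ := hs.exists_bound_of_continuousOn hH
  refine integrable_essSup (M := M) (fun x y => hM _ (hfg _ _)) fun x => ?_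
  refine Metric.equicontinuousAt_iff_right.2 fun ε hε => ?_
  obtain ⟨η, hη, hu⟩ := Metric.uniformContinuousOn_iff.1
    (hs.uniformContinuousOn_of_continuous hH) ε hε
  obtain ⟨θ, hθ, hv⟩ := Metric.uniformContinuous_iff.1 hf η hη
  have hcont : Tendsto (fun x' : Euc n => dist (a⁻¹ • x) (a⁻¹ • x')) (𝓝 x) (𝓝 0) := by
    have : Continuous fun x' : Euc n => dist (a⁻¹ • x) (a⁻¹ • x') := by fun_prop
    simpa using this.tendsto x
  filter_upwards [hcont.eventually (gt_mem_nhds hθ)] with x' hx' y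
  refine hu _ (hfg _ _) _ (hfg _ _) ?_
  rw [Prod.dist_eq, dist_self]
  refine max_lt (hv ?_) hη
  rwa [smul_sub, smul_sub, dist_sub_right]

theorem uniformContinuous_clamp_add_sq {δ : ℝ} (hδ : 0 < δ) (p : ℝ) :
    UniformContinuous fun t => clamp δ t + p * clamp δ t ^ 2 := by
  refine (LipschitzWith.of_dist_le' (K := 1 + 2 * |p| * δ) fun s t => ?_).uniformContinuous
  rw [Real.dist_eq, Real.dist_eq]
  have h1 := abs_clamp_sub_clamp_le δ s t
  have h2 : |clamp δ s + clamp δ t| ≤ 2 * δ :=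
    (abs_add_le _ _).trans (by linarith [abs_clamp_le hδ s, abs_clamp_le hδ t])
  calc |clamp δ s + p * clamp δ s ^ 2 - (clamp δ t + p * clamp δ t ^ 2)|
      = |(1 + p * (clamp δ s + clamp δ t)) * (clamp δ s - clamp δ t)| := by congr 1; ring
    _ = |1 + p * (clamp δ s + clamp δ t)| * |clamp δ s - clamp δ t| := abs_mul _ _
    _ ≤ (1 + |p| * (2 * δ)) * |s - t| := by
        gcongr
        refine (abs_add_le _ _).trans ?_
        rw [abs_one, abs_mul]
        gcongr
    _ = _ := by ring

theorem integrable_clamp_add_sq {n : ℕ} {μ : Measure (Euc n)} [IsFiniteMeasure μ] {δ : ℝ}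
    (hδ : 0 < δ) (p c : ℝ) (i : Fin n) :
    Integrable (fun x : Euc n => clamp δ (c * x i) + p * clamp δ (c * x i) ^ 2) μ := by
  have hcont := (uniformContinuous_clamp_add_sq hδ p).continuous
  refine Integrable.of_bound (C := δ + |p| * δ ^ 2) (hcont.comp (by fun_prop :
    Continuous fun x : Euc n => c * x i)).aestronglyMeasurable (ae_of_all _ fun x => ?_)
  have := abs_clamp_le hδ (c * x i)
  refine (abs_add_le _ _).trans ?_
  rw [abs_mul, abs_pow]
  gcongr

theorem isBigO_integral_clamp {n : ℕ} {μ : Measure (Euc n)} [IsProbabilityMeasure μ]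
    (hmom : Integrable (fun x : Euc n => ‖x‖ ^ 5) μ) (i : Fin n) {δ : ℝ} (hδ : 0 < δ) (p c : ℝ) :
    (fun ε => ∫ x, (clamp δ (c * ε * x i) + p * clamp δ (c * ε * x i) ^ 2) ∂μ
      - (c * (∫ x, x i ∂μ) * ε + p * c ^ 2 * (∫ x, x i ^ 2 ∂μ) * ε ^ 2))
      =O[𝓝 0] fun ε => ε ^ 3 := by
  obtain ⟨K, hK0, hK⟩ := exists_abs_clamp_add_sq_sub_le hδ p
  have h1 := integrable_coord hmom i
  have h2 := integrable_coord_sq hmom i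
  have h3 := integrable_abs_coord_pow hmom i (k := 3) (by norm_num)
  refine IsBigO.of_bound (K * |c| ^ 3 * ∫ x, |x i| ^ 3 ∂μ) (Eventually.of_forall fun ε => ?_)
  have hbd := integrable_clamp_add_sq (μ := μ) hδ p (c * ε) i
  have hlin : Integrable (fun x : Euc n => c * ε * x i) μ := h1.const_mul _
  have hquad : Integrable (fun x : Euc n => p * (c * ε) ^ 2 * x i ^ 2) μ := h2.const_mul _
  have hpoly : c * (∫ x, x i ∂μ) * ε + p * c ^ 2 * (∫ x, x i ^ 2 ∂μ) * ε ^ 2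
      = ∫ x, (c * ε * x i + p * (c * ε) ^ 2 * x i ^ 2) ∂μ := by
    rw [integral_add hlin hquad, integral_const_mul, integral_const_mul]
    ring
  have hsum : Integrable (fun x : Euc n => c * ε * x i + p * (c * ε) ^ 2 * x i ^ 2) μ :=
    hlin.add hquad
  rw [hpoly, ← integral_sub hbd hsum]
  refine (norm_integral_le_integral_norm _).trans ?_
  calc ∫ x, ‖clamp δ (c * ε * x i) + p * clamp δ (c * ε * x i) ^ 2
        - (c * ε * x i + p * (c * ε) ^ 2 * x i ^ 2)‖ ∂μ
      ≤ ∫ x, K * |c| ^ 3 * |ε| ^ 3 * |x i| ^ 3 ∂μ := by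
        refine integral_mono (hbd.sub hsum).norm (h3.const_mul _) fun x => ?_
        have := hK (c * ε * x i)
        rw [abs_mul (c * ε), abs_mul c] at this
        calc _ = |clamp δ (c * ε * x i) + p * clamp δ (c * ε * x i) ^ 2
                - (c * ε * x i + p * (c * ε * x i) ^ 2)| := by
              rw [norm_eq_abs]; congr 1; ring
          _ ≤ _ := this
          _ = _ := by ring
    _ = _ := by
        rw [integral_const_mul, norm_pow, norm_eq_abs]
        ring

theorem second_order_conditions {n : ℕ} {P Q : ℝ × ℝ} {H : ℝ × ℝ → ℝ}
    (hH : ContDiffOn ℝ 3 H (Set.Icc P Q)) {z : ℝ × ℝ} (hz : z ∈ interior (Set.Icc P Q))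
    (hx : Hx H z ≠ 0) (hy : Hy H z ≠ 0) {a b : ℝ} (ha : 0 < a) (hb : 0 < b)
    {μ : Measure (Euc n)} [IsProbabilityMeasure μ]
    (hmom : Integrable (fun x : Euc n => ‖x‖ ^ 5) μ)
    (hstar : StarIneq a b (Set.Icc P Q) H μ) (i : Fin n) {A B C : ℝ}
    (hA : A = Hxx H z / Hx H z ^ 2) (hB : B = Hxy H z / (Hx H z * Hy H z))
    (hC : C = Hyy H z / Hy H z ^ 2) {l : ℝ} (hl : 0 < l) (t : ℝ) :
    ∫ x, x i ∂μ - (a * (∫ x, x i ∂μ) + b * ∫ x, x i ∂μ) = 0 ∧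
      0 ≤ (B / 2 - l * (t * (1 - t))) * (∫ x, x i ^ 2 ∂μ)
        - ((B / 2 - A / 2 - l * t) * a ^ 2 * (∫ x, x i ^ 2 ∂μ)
          + (B / 2 - C / 2 - l * (1 - t)) * b ^ 2 * (∫ x, x i ^ 2 ∂μ)
          + A / 2 * (a * ∫ x, x i ∂μ) ^ 2 + B * (a * (∫ x, x i ∂μ) * (b * ∫ x, x i ∂μ))
          + C / 2 * (b * ∫ x, x i ∂μ) ^ 2) := by
  obtain ⟨K₀, hK₀, δ₀, hδ₀, hloc⟩ := exists_local_expansion hH hz hx hy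
  rw [← hA, ← hB, ← hC] at hloc
  generalize Hx H z = u at *
  generalize Hy H z = v at *
  obtain ⟨h, hh⟩ : ∃ h : ℝ → ℝ → ℝ, ∀ r s, h r s = H (z.1 + r / u, z.2 + s / v) :=
    ⟨_, fun _ _ => rfl⟩
  have hexp : ∀ r s, |r| ≤ δ₀ → |s| ≤ δ₀ →
      |h r s - (H z + r + s + A / 2 * r ^ 2 + B * r * s + C / 2 * s ^ 2)|
        ≤ K₀ * (|r| + |s|) ^ 3 := fun r s hr hs => by
    rw [hh]; exact (hloc r s hr hs).2
  set p := B / 2 - A / 2 - l * t with hp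
  set q := B / 2 - C / 2 - l * (1 - t) with hq
  obtain ⟨K₁, hK₁, δ₁, hδ₁, hcomp⟩ := exists_expansion_comp hK₀ hδ₀ hexp p q
  obtain ⟨δ, hδ, hδδ₁, K, hK, hbound⟩ := exists_clamp_upper_bound (B := B) (t := t)
    (G := fun α β => h (α + p * α ^ 2) (β + q * β ^ 2)) (h₀ := H z) hK₁ hδ₁ hl
    fun α β hα hβ => by
      have := (abs_le.1 (hcomp α β hα hβ).2.2).2
      rw [hp, hq] at this ⊢
      linarith
  have h1 := integrable_coord hmom i
  have h2 := integrable_coord_sq hmom i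
  have h3 := integrable_abs_coord_pow hmom i (k := 3) (by norm_num)
  refine coeff_comparison (h := h) (L := K * ∫ x, |x i| ^ 3 ∂μ) hδ₀ hexp
    (isBigO_integral_clamp hmom i hδ p a) (isBigO_integral_clamp hmom i hδ q b) fun ε => ?_
  have huc : ∀ p' c w w' : ℝ, UniformContinuous fun x : Euc n =>
      w + (clamp δ (c * ε * x i) + p' * clamp δ (c * ε * x i) ^ 2) / w' := by
    intro p' c w w'
    have hlin : UniformContinuous fun x : Euc n => c * ε * x i :=
      (uniformContinuous_const_smul (c * ε)).comp
        (EuclideanSpace.proj (𝕜 := ℝ) i).uniformContinuous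
    have := ((uniformContinuous_clamp_add_sq hδ p').comp hlin).const_smul w'⁻¹
    refine (uniformContinuous_const (b := w)).add (this.congr fun x => ?_)
    simp [div_eq_inv_mul]
  have hbdd : ∀ c (x : Euc n), |clamp δ (c * ε * x i)| ≤ δ₁ := fun c x =>
    (abs_clamp_le hδ _).trans hδδ₁
  set f : Euc n → ℝ := fun x =>
    z.1 + (clamp δ (a * ε * x i) + p * clamp δ (a * ε * x i) ^ 2) / u with hf
  set g : Euc n → ℝ := fun x =>
    z.2 + (clamp δ (b * ε * x i) + q * clamp δ (b * ε * x i) ^ 2) / v with hg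
  have hmem : ∀ x y, (f x, g y) ∈ Set.Icc P Q := fun x y => by
    have := hcomp _ _ (hbdd a x) (hbdd b y)
    exact (hloc _ _ this.1 this.2.1).1
  have hst := hstar f g (huc p a z.1 u).continuous.measurable (huc q b z.2 v).continuous.measurable
    hmem
  have hint : ∀ p' c w w' : ℝ,
      ∫ x : Euc n, (w + (clamp δ (c * ε * x i) + p' * clamp δ (c * ε * x i) ^ 2) / w') ∂μ =
      w + (∫ x, (clamp δ (c * ε * x i) + p' * clamp δ (c * ε * x i) ^ 2) ∂μ) / w' := by
    intro p' c w w'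
    rw [integral_add (integrable_const _)
      ((integrable_clamp_add_sq hδ p' (c * ε) i).div_const _), integral_div]
    simp
  rw [hf, hg, hint p a, hint q b, ← hh] at hst
  refine hst.trans ?_
  have hi1 : Integrable (fun x : Euc n => H z + ε * x i) μ :=
    (integrable_const _).add (h1.const_mul _)
  have hi2 : Integrable (fun x : Euc n => H z + ε * x i
      + (B / 2 - l * (t * (1 - t))) * ε ^ 2 * x i ^ 2) μ := hi1.add (h2.const_mul _)
  calc _ ≤ ∫ x : Euc n, (H z + ε * x i + (B / 2 - l * (t * (1 - t))) * ε ^ 2 * x i ^ 2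
        + K * |ε| ^ 3 * |x i| ^ 3) ∂μ := by
        refine integral_mono (integrable_essSup_comp isCompact_Icc hH.continuousOn
          (huc p a z.1 u) hmem a b) (hi2.add (h3.const_mul _)) fun x => ?_
        obtain ⟨M, hM⟩ := isCompact_Icc.exists_bound_of_continuousOn hH.continuousOn
        refine essSup_le_of_forall_le (M := M) (fun y => (abs_le.1 (hM _ (hmem _ _))).1)
          fun y => ?_
        have hb1 := hbound (ε * x i) (ε * y i)
        have ea : a * ε * (a⁻¹ • (x - y)) i = ε * x i - ε * y i := by
          simp; field_simp
        have eb : b * ε * (b⁻¹ • y) i = ε * y i := by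
          simp; field_simp
        simp only [hh] at hb1
        beta_reduce
        rw [ea, eb]
        refine hb1.trans (le_of_eq ?_)
        rw [abs_mul]
        ring
    _ = _ := by
        rw [integral_add hi2 (h3.const_mul _), integral_add hi1 (h2.const_mul _),
          integral_add (integrable_const _) (h1.const_mul _), integral_const_mul,
          integral_const_mul, integral_const_mul]
        simp
        ring

theorem nonneg_and_nonneg_of_forall_add_mul {X Y : ℝ} (h : ∀ l > 0, 0 ≤ X + l * Y) :
    0 ≤ X ∧ 0 ≤ Y := by
  constructor
  · have : Tendsto (fun l : ℝ => X + l * Y) (𝓝[>] 0) (𝓝 X) := by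
      refine tendsto_nhdsWithin_of_tendsto_nhds ?_
      have : Continuous fun l : ℝ => X + l * Y := by fun_prop
      simpa using this.tendsto 0
    exact ge_of_tendsto this (eventually_mem_nhdsWithin.mono h)
  · by_contra! hY
    have := h ((|X| + 1) / -Y) (div_pos (by positivity) (by linarith))
    rw [div_neg, neg_mul, div_mul_cancel₀ _ hY.ne] at this
    linarith [le_abs_self X]

theorem integrable_id_of_norm_pow {n : ℕ} {μ : Measure (Euc n)} [IsProbabilityMeasure μ]
    (hmom : Integrable (fun x : Euc n => ‖x‖ ^ 5) μ) : Integrable (fun x : Euc n => x) μ := by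
  refine ((integrable_const (1 : ℝ)).add hmom).mono' (by fun_prop) (ae_of_all _ fun x => ?_)
  simp only [Pi.add_apply]
  rcases le_total ‖x‖ 1 with h | h
  · linarith [pow_nonneg (norm_nonneg x) 5]
  · linarith [le_self_pow₀ h (show 5 ≠ 0 by norm_num)]

theorem interior_Icc_prod_nonempty {P Q : ℝ × ℝ} (h₁ : P.1 < Q.1) (h₂ : P.2 < Q.2) :
    (interior (Set.Icc P Q)).Nonempty := by
  have : Set.Icc P Q = Set.Icc P.1 Q.1 ×ˢ Set.Icc P.2 Q.2 := by
    rw [Set.Icc_prod_Icc]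
  rw [this, interior_prod_eq, interior_Icc, interior_Icc]
  exact (Set.nonempty_Ioo.2 h₁).prod (Set.nonempty_Ioo.2 h₂)

/-- necessity of the conditions (numbers) for inequality (★). -/
theorem stmt0 (n : ℕ) (hn : 1 ≤ n) (P Q : ℝ × ℝ) (hPQ1 : P.1 < Q.1) (hPQ2 : P.2 < Q.2)
    (H : ℝ × ℝ → ℝ) (hH : ContDiffOn ℝ 3 H (Set.Icc P Q))
    (hHx : ∀ z ∈ interior (Set.Icc P Q), Hx H z ≠ 0)
    (hHy : ∀ z ∈ interior (Set.Icc P Q), Hy H z ≠ 0)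
    (a b : ℝ) (ha : 0 < a) (hb : 0 < b)
    (μ : Measure (Euc n)) (hprob : IsProbabilityMeasure μ) (hac : μ ≪ volume)
    (hmom : Integrable (fun x => ‖x‖ ^ 5) μ)
    (hstar : StarIneq a b (Set.Icc P Q) H μ) :
    (∀ z ∈ interior (Set.Icc P Q),
      0 ≤ a ^ 2 * Hxx H z / (Hx H z) ^ 2
          + (1 - a ^ 2 - b ^ 2) * Hxy H z / (Hx H z * Hy H z)
          + b ^ 2 * Hyy H z / (Hy H z) ^ 2) ∧
    |1 - a ^ 2 - b ^ 2| ≤ 2 * a * b ∧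
    (1 < a + b → ∫ x, x ∂μ = 0) := by
  set i₀ : Fin n := ⟨0, hn⟩
  have key := fun z hz i (l : ℝ) (hl : 0 < l) (t : ℝ) => second_order_conditions hH hz (hHx z hz)
    (hHy z hz) ha hb hmom hstar i rfl rfl rfl hl t
  have coeffs : ∀ z ∈ interior (Set.Icc P Q),
      (0 ≤ a ^ 2 * Hxx H z / (Hx H z) ^ 2
          + (1 - a ^ 2 - b ^ 2) * Hxy H z / (Hx H z * Hy H z)
          + b ^ 2 * Hyy H z / (Hy H z) ^ 2) ∧
      ∀ t, 0 ≤ a ^ 2 * t + b ^ 2 * (1 - t) - t * (1 - t) := by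
    intro z hz
    have hz' := key z hz i₀
    have hvar := variance_coord_pos hac hmom i₀
    rw [mul_div_assoc, mul_div_assoc, mul_div_assoc]
    generalize Hxx H z / (Hx H z) ^ 2 = A at *
    generalize Hxy H z / (Hx H z * Hy H z) = B at *
    generalize Hyy H z / (Hy H z) ^ 2 = C at *
    generalize ∫ x, x i₀ ∂μ = m at *
    generalize ∫ x, x i₀ ^ 2 ∂μ = s at *
    have hm : m * (1 - a - b) = 0 := by linarith [(hz' 1 one_pos 0).1]
    have hsplit := fun t => nonneg_and_nonneg_of_forall_add_mul
      (X := (s - m ^ 2) * (a ^ 2 * A + (1 - a ^ 2 - b ^ 2) * B + b ^ 2 * C))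
      (Y := 2 * s * (a ^ 2 * t + b ^ 2 * (1 - t) - t * (1 - t))) fun l hl => by
        linear_combination 2 * (hz' l hl t).2 + m * (1 + a + b) * B * hm
    have hs : 0 < s := by linarith [sq_nonneg m]
    exact ⟨nonneg_of_mul_nonneg_right (hsplit 0).1 hvar,
      fun t => nonneg_of_mul_nonneg_right (hsplit t).2 (by positivity)⟩
  obtain ⟨z, hz⟩ := interior_Icc_prod_nonempty hPQ1 hPQ2
  refine ⟨fun z hz => (coeffs z hz).1, ?_, fun hab => ?_⟩
  · have h := (coeffs z hz).2 ((1 + b ^ 2 - a ^ 2) / 2)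
    refine abs_le_of_sq_le_sq ?_ (by positivity)
    linarith
  · ext i
    have h := (key z hz i 1 one_pos 0).1
    have hi : (∫ x, x ∂μ) i = ∫ x, x i ∂μ :=
      ((EuclideanSpace.proj (𝕜 := ℝ) i).integral_comp_comm (integrable_id_of_norm_pow hmom)).symm
    have hm : (∫ x, x i ∂μ) * (1 - a - b) = 0 := by linarith
    rw [hi]
    exact (mul_eq_zero.1 hm).resolve_right (by linarith)

end
end

section
/- Let a, b > 0 and let A, B, C be real numbers. Then the inequality (pC + pq + qA + (AC − B²))/(A + p − 2B + C + q) ≥ p a² + q b² holds for all real numbers p, q satisfying p + q + A − 2B + C < 0 if and only if ((1 − a² − b²)/(2ab))² ≤ 1 and a² A + (1 − a² − b²) B + b² C ≥ 0. -/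
/-- Shifting `p` and `q` diagonalizes the rational inequality: on the half-plane `x + y < 0` it is
equivalent to nonnegativity of a quadratic form plus a linear term. -/
lemma div_ineq_iff_quadratic (a b A B C x y : ℝ) (h : x + y < 0) :
    ((x + B - A) * a ^ 2 + (y + B - C) * b ^ 2 ≤
      ((x + B - A) * C + (x + B - A) * (y + B - C) + (y + B - C) * A + (A * C - B ^ 2))
        / (A + (x + B - A) - 2 * B + C + (y + B - C))) ↔
    0 ≤ a ^ 2 * x ^ 2 - (1 - a ^ 2 - b ^ 2) * (x * y) + b ^ 2 * y ^ 2
      - (x + y) * (a ^ 2 * A + (1 - a ^ 2 - b ^ 2) * B + b ^ 2 * C) := by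
  have hd : A + (x + B - A) - 2 * B + C + (y + B - C) = x + y := by ring
  rw [hd, le_div_iff_of_neg h, ← sub_nonneg]
  apply iff_of_eq
  congr 1
  ring

/-- A quadratic form plus a linear term is nonnegative on a half-plane iff the form is positive
semidefinite and the linear term has the right sign. -/
lemma quadratic_nonneg_halfplane_iff (a b K : ℝ) (ha : 0 < a) :
    (∀ x y : ℝ, x + y < 0 →
      0 ≤ a ^ 2 * x ^ 2 - (1 - a ^ 2 - b ^ 2) * (x * y) + b ^ 2 * y ^ 2 - (x + y) * K) ↔
    ((1 - a ^ 2 - b ^ 2) ^ 2 ≤ 4 * a ^ 2 * b ^ 2 ∧ 0 ≤ K) := by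
  have ha2 : 0 < a ^ 2 := by positivity
  constructor
  · intro h
    have hK : 0 ≤ K := by
      by_contra! hK
      have key : ∀ t : ℝ, 0 < t → 0 ≤ t * (2 * a ^ 2 + 2 * b ^ 2 - 1) + 2 * K := by
        intro t ht
        have := h (-t) (-t) (by linarith)
        refine nonneg_of_mul_nonneg_right (a := t) ?_ ht
        linarith
      have hR : 0 < 2 * a ^ 2 + 2 * b ^ 2 - 1 := by linarith [key 1 one_pos]
      have := key (-K / (2 * a ^ 2 + 2 * b ^ 2 - 1)) (div_pos (neg_pos.2 hK) hR)
      rw [div_mul_cancel₀ _ hR.ne'] at this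
      linarith
    refine ⟨?_, hK⟩
    by_contra! hc
    set c := 1 - a ^ 2 - b ^ 2 with hcdef
    set N := a ^ 2 * (4 * a ^ 2 * b ^ 2 - c ^ 2) with hN
    have hN0 : N < 0 := mul_neg_of_pos_of_neg ha2 (by linarith)
    have hs : c + 2 * a ^ 2 ≠ 0 := by
      intro hs
      have hc' : c = -2 * a ^ 2 := by linarith
      have hb' : b ^ 2 = 1 + a ^ 2 := by linarith
      rw [hc', hb'] at hc
      nlinarith
    have hs2 : 0 < (c + 2 * a ^ 2) ^ 2 := by positivity
    set r := (K + 1) / (-N) with hr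
    have hr0 : 0 < r := div_pos (by linarith) (by linarith)
    have hrN : r * N = -(K + 1) := by rw [hr]; field_simp [hN0.ne]
    have := h (-(r * (c + 2 * a ^ 2)) * c) (-(r * (c + 2 * a ^ 2)) * (2 * a ^ 2))
      (by nlinarith [mul_pos hr0 hs2])
    have e : a ^ 2 * (-(r * (c + 2 * a ^ 2)) * c) ^ 2
        - c * (-(r * (c + 2 * a ^ 2)) * c * (-(r * (c + 2 * a ^ 2)) * (2 * a ^ 2)))
        + b ^ 2 * (-(r * (c + 2 * a ^ 2)) * (2 * a ^ 2)) ^ 2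
        - (-(r * (c + 2 * a ^ 2)) * c + -(r * (c + 2 * a ^ 2)) * (2 * a ^ 2)) * K
        = r * (c + 2 * a ^ 2) ^ 2 * (r * N + K) := by
      rw [hN]; ring
    rw [e, hrN] at this
    nlinarith [mul_pos hr0 hs2]
  · rintro ⟨hc, hK⟩ x y hxy
    have h1 : 0 ≤ a ^ 2 * x ^ 2 - (1 - a ^ 2 - b ^ 2) * (x * y) + b ^ 2 * y ^ 2 := by
      refine nonneg_of_mul_nonneg_right (a := 4 * a ^ 2) ?_ (by positivity)
      have h2 := mul_nonneg (sub_nonneg.2 hc) (sq_nonneg y)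
      have h3 := sq_nonneg (2 * a ^ 2 * x - (1 - a ^ 2 - b ^ 2) * y)
      linarith
    have := mul_nonneg (neg_nonneg.2 hxy.le) hK
    linarith

/-- the purely algebraic equivalence between the quadratic-form
inequality on a half-plane and the conditions (numbers). -/
theorem stmt3 (a b A B C : ℝ) (ha : 0 < a) (hb : 0 < b) :
    (∀ p q : ℝ, p + q + A - 2 * B + C < 0 →
      p * a ^ 2 + q * b ^ 2 ≤ (p * C + p * q + q * A + (A * C - B ^ 2))
        / (A + p - 2 * B + C + q)) ↔
    (((1 - a ^ 2 - b ^ 2) / (2 * a * b)) ^ 2 ≤ 1 ∧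
      0 ≤ a ^ 2 * A + (1 - a ^ 2 - b ^ 2) * B + b ^ 2 * C) := by
  have hdisc : ((1 - a ^ 2 - b ^ 2) / (2 * a * b)) ^ 2 ≤ 1 ↔
      (1 - a ^ 2 - b ^ 2) ^ 2 ≤ 4 * a ^ 2 * b ^ 2 := by
    rw [div_pow, div_le_one (by positivity)]
    ring_nf
  rw [hdisc, ← quadratic_nonneg_halfplane_iff a b _ ha]
  constructor
  · intro h x y hxy
    exact (div_ineq_iff_quadratic a b A B C x y hxy).1
      (h (x + B - A) (y + B - C) (by linarith))
  · intro h p q hpq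
    have hxy : (p + A - B) + (q + C - B) < 0 := by linarith
    have := (div_ineq_iff_quadratic a b A B C _ _ hxy).2 (h _ _ hxy)
    have hp : p + A - B + B - A = p := by ring
    have hq : q + C - B + B - C = q := by ring
    rwa [hp, hq] at this
end
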